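/- Let d ∈ {3, 5, 7, 11, 13, 17, 19} and let (a, b) be one of the pairs (1, ±4), (7, ±4), (21, ±4), (9, ±2), (8, ±1), (12, ±7), (12, ±1), (13, ±2), (13, ±8), (1, ±6), (14, ±1), (18, ±5), excluding the pairs (1, ±4), (7, ±4), (21, ±4) when d = 3, the pair (14, ±1) when d = 5, and the pair (7, ±4) when d = 7. Then for every n ≥ 0 there is no integer x with a·uₙ + b·vₙ = x^d. -/

import Mathlib

/-- The integer `x` is neither `0` nor a `d`-th power residue modulo the prime `p`
(meaningful when `d ∣ p - 1`). -/
def isNonPowerMod (d : ℕ) (x : ℤ) (p : ℕ) : Bool :=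
  1 < (x % p).toNat ^ ((p - 1) / d) % p

/-- Run through `k` terms of the Fibonacci-type sequence starting with `x, y`, testing that each
term is a `d`-th power nonresidue modulo some element of `ps`, and that the following two terms are
congruent to `x₀, y₀` modulo every element of `ps`. -/
def sieve (d : ℕ) (ps : List ℕ) (x₀ y₀ : ℤ) : ℕ → ℤ → ℤ → Bool
  | 0, x, y => ps.all fun p => (x - x₀) % p == 0 && (y - y₀) % p == 0
  | k + 1, x, y => ps.any (isNonPowerMod d x) && sieve d ps x₀ y₀ k y (x + y)

/-- A period and a list of primes congruent to `1` modulo `d` that serve to sieve out the `d`-th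
powers. -/
def sieveData : ℕ → ℕ × List ℕ
  | 3 => (540, [19, 31, 61, 109, 181, 541, 811])
  | 5 => (80, [11, 41, 2161])
  | 7 => (126, [29, 211, 1009])
  | 11 => (176, [89, 199, 881])
  | 13 => (78, [79, 521, 859])
  | 17 => (102, [919, 3469])
  | 19 => (570, [191, 229, 9349])
  | _ => (0, [])

lemma isNonPowerMod_pow_eq_false {d p : ℕ} (hp : p.Prime) (hd : d ∣ p - 1) (x : ℤ) :
    isNonPowerMod d (x ^ d) p = false := by
  have := Fact.mk hp
  have hp1 := hp.one_lt
  have key : (((x ^ d % p).toNat ^ ((p - 1) / d) % p : ℕ) : ZMod p) = (x : ZMod p) ^ (p - 1) := by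
    have h0 : 0 ≤ x ^ d % p := Int.emod_nonneg _ (by exact_mod_cast hp.ne_zero)
    have h1 : (((x ^ d % p).toNat : ℕ) : ZMod p) = (x : ZMod p) ^ d := by
      rw [← Int.cast_natCast (R := ZMod p), Int.toNat_of_nonneg h0, ZMod.intCast_mod, Int.cast_pow]
    rw [ZMod.natCast_mod, Nat.cast_pow, h1, ← pow_mul, Nat.mul_div_cancel' hd]
  have hlt : (x ^ d % p).toNat ^ ((p - 1) / d) % p < p := Nat.mod_lt _ hp.pos
  rw [isNonPowerMod, decide_eq_false_iff_not, not_lt]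
  generalize (x ^ d % p).toNat ^ ((p - 1) / d) % p = t at key hlt
  by_cases hx : (x : ZMod p) = 0
  · rw [hx, zero_pow (by omega), ZMod.natCast_eq_zero_iff] at key
    rw [Nat.eq_zero_of_dvd_of_lt key hlt]
    exact zero_le_one
  · rw [ZMod.pow_card_sub_one_eq_one hx, ← Nat.cast_one, ZMod.natCast_eq_natCast_iff] at key
    exact (key.eq_of_lt_of_lt hlt hp1).le

lemma isNonPowerMod_congr {d p : ℕ} {x y : ℤ} (h : x ≡ y [ZMOD p]) :
    isNonPowerMod d x p = isNonPowerMod d y p := by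
  rw [isNonPowerMod, isNonPowerMod, h.eq]

lemma exists_isNonPowerMod_of_sieve {d : ℕ} {ps : List ℕ} {x₀ y₀ : ℤ} {w : ℕ → ℤ}
    (hw : ∀ n, w (n + 2) = w n + w (n + 1)) {k m : ℕ}
    (h : sieve d ps x₀ y₀ k (w m) (w (m + 1)) = true) :
    (∀ i < k, ∃ p ∈ ps, isNonPowerMod d (w (m + i)) p = true) ∧
      ∀ p ∈ ps, w (m + k) ≡ x₀ [ZMOD p] ∧ w (m + k + 1) ≡ y₀ [ZMOD p] := by
  induction k generalizing m with
  | zero =>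
    refine ⟨fun i hi => absurd hi (Nat.not_lt_zero i), fun p hp => ?_⟩
    simp only [sieve, List.all_eq_true, Bool.and_eq_true, beq_iff_eq] at h
    exact (h p hp).imp Int.emod_eq_emod_iff_emod_sub_eq_zero.mpr
      Int.emod_eq_emod_iff_emod_sub_eq_zero.mpr
  | succ k ih =>
    rw [sieve, Bool.and_eq_true, ← hw, List.any_eq_true] at h
    obtain ⟨h₁, h₂⟩ := ih h.2
    rw [add_right_comm, add_assoc] at h₂
    refine ⟨fun i hi => ?_, h₂⟩
    cases i with
    | zero => exact h.1
    | succ i =>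
      rw [← add_assoc, add_right_comm]
      exact h₁ i (Nat.lt_of_succ_lt_succ hi)

lemma modEq_of_recurrence {w : ℕ → ℤ} (hw : ∀ n, w (n + 2) = w n + w (n + 1)) {M : ℕ} {q : ℤ}
    (h₀ : w M ≡ w 0 [ZMOD q]) (h₁ : w (M + 1) ≡ w 1 [ZMOD q]) (n : ℕ) :
    w (n + M) ≡ w n [ZMOD q] := by
  induction n using Nat.twoStepInduction with
  | zero => rwa [zero_add]
  | one => rwa [add_comm]
  | more n ih₀ ih₁ =>
    rw [hw, show n + 2 + M = n + M + 2 by ring, hw, show n + M + 1 = n + 1 + M by ring]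
    exact ih₀.add ih₁

lemma ne_pow_of_sieve {d M : ℕ} {ps : List ℕ} (hps : ∀ p ∈ ps, p.Prime ∧ d ∣ p - 1) (hM : 0 < M)
    {w : ℕ → ℤ} (hw : ∀ n, w (n + 2) = w n + w (n + 1))
    (h : sieve d ps (w 0) (w 1) M (w 0) (w 1) = true) (n : ℕ) (x : ℤ) : w n ≠ x ^ d := by
  intro hx
  obtain ⟨h₁, h₂⟩ := exists_isNonPowerMod_of_sieve hw (m := 0) h
  simp only [zero_add] at h₁ h₂
  obtain ⟨p, hp, hnp⟩ := h₁ (n % M) (Nat.mod_lt n hM)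
  have hper : ∀ j r, w (r + M * j) ≡ w r [ZMOD p] := by
    intro j r
    induction j with
    | zero => rfl
    | succ j ih =>
      rw [Nat.mul_succ, ← add_assoc]
      exact (modEq_of_recurrence hw (h₂ p hp).1 (h₂ p hp).2 _).trans ih
  have hmod := hper (n / M) (n % M)
  rw [Nat.mod_add_div, hx] at hmod
  rw [← isNonPowerMod_congr hmod, isNonPowerMod_pow_eq_false (hps p hp).1 (hps p hp).2] at hnp
  exact Bool.false_ne_true hnp

lemma sieveData_spec {d : ℕ} (hd : d ∈ [3, 5, 7, 11, 13, 17, 19]) :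
    0 < (sieveData d).1 ∧ ∀ p ∈ (sieveData d).2, p.Prime ∧ d ∣ p - 1 := by
  fin_cases hd <;> norm_num [sieveData]

lemma sieve_sieveData : ∀ d ∈ [3, 5, 7, 11, 13, 17, 19],
    ∀ q ∈ ([(1, 4), (1, -4), (7, 4), (7, -4), (21, 4), (21, -4),
      (9, 2), (9, -2), (8, 1), (8, -1), (12, 7), (12, -7), (12, 1), (12, -1),
      (13, 2), (13, -2), (13, 8), (13, -8), (1, 6), (1, -6), (14, 1), (14, -1),
      (18, 5), (18, -5)] : List (ℤ × ℤ)),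
    (d = 3 → q ∉ ([(1, 4), (1, -4), (7, 4), (7, -4), (21, 4), (21, -4)] : List (ℤ × ℤ))) →
    (d = 5 → q ∉ ([(14, 1), (14, -1)] : List (ℤ × ℤ))) →
    (d = 7 → q ∉ ([(7, 4), (7, -4)] : List (ℤ × ℤ))) →
    sieve d (sieveData d).2 (2 * q.2) (q.1 + q.2) (sieveData d).1 (2 * q.2) (q.1 + q.2) = true := by
  decide +kernel


/-- The Fibonacci numbers as integers: `u₀ = 0`, `u₁ = 1`, `u_{n+2} = u_{n+1} + uₙ`. -/
def fibZ (n : ℕ) : ℤ := Nat.fib n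

/-- The Lucas numbers: `v₀ = 2`, `v₁ = 1`, `v_{n+2} = v_{n+1} + vₙ`. -/
def lucasZ : ℕ → ℤ
  | 0 => 2
  | 1 => 1
  | n + 2 => lucasZ (n + 1) + lucasZ n

theorem no_dth_powers_in_fib_type_sequences (d : ℕ)
    (hd : d ∈ ({3, 5, 7, 11, 13, 17, 19} : Set ℕ)) (a b : ℤ)
    (hab : (a, b) ∈ ({(1, 4), (1, -4), (7, 4), (7, -4), (21, 4), (21, -4),
      (9, 2), (9, -2), (8, 1), (8, -1), (12, 7), (12, -7), (12, 1), (12, -1),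
      (13, 2), (13, -2), (13, 8), (13, -8), (1, 6), (1, -6), (14, 1), (14, -1),
      (18, 5), (18, -5)} : Set (ℤ × ℤ)))
    (h3 : d = 3 → (a, b) ∉ ({(1, 4), (1, -4), (7, 4), (7, -4), (21, 4), (21, -4)} :
      Set (ℤ × ℤ)))
    (h5 : d = 5 → (a, b) ∉ ({(14, 1), (14, -1)} : Set (ℤ × ℤ)))
    (h7 : d = 7 → (a, b) ∉ ({(7, 4), (7, -4)} : Set (ℤ × ℤ))) :
    ∀ n : ℕ, ¬ ∃ x : ℤ, a * fibZ n + b * lucasZ n = x ^ d := by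
  have hd' : d ∈ [3, 5, 7, 11, 13, 17, 19] := by simpa using hd
  have h := sieve_sieveData d hd' (a, b) (by simpa using hab) (fun h => by simpa using h3 h)
    (fun h => by simpa using h5 h) (fun h => by simpa using h7 h)
  rintro n ⟨x, hx⟩
  refine ne_pow_of_sieve (sieveData_spec hd').2 (sieveData_spec hd').1
    (w := fun n => a * fibZ n + b * lucasZ n) (fun n => ?_) ?_ n x hx
  · simp only [fibZ, lucasZ, Nat.fib_add_two, Nat.cast_add]
    ring
  · simpa [fibZ, lucasZ, mul_comm b 2] using h
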